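/- If Γ ⊢ M : α is derivable in the parallel λ-calculus λ_pr, then ⌈Γ⌉ ⊢ᵃᵐ ⌈M⌉ : ⌈α⌉ is derivable in the monadic fragment λᵃᵐ_pr of the concurrent administrative λ-calculus λᵃ_pr. -/

import Mathlib

/-!
Formalization of the calculi of "A decompilation of the π-calculus and its
application to termination" (R. Amadio), parallel/concurrent case.

Variables are named (natural numbers); terms are manipulated up to
α-renaming via an explicitly defined α-equivalence relation, and
substitution is the textbook (naive) one, in accordance with the paper's
convention that bound variables are suitably renamed.
-/

namespace DecompPi

abbrev Var := ℕ

/-! ## λ_pr : the parallel λ-calculus -/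

/-! Value types `A ::= 1 | A → α` and types `α ::= A | b`. -/
mutual
  inductive PVTy : Type
    | unit : PVTy
    | arr : PVTy → PTy → PVTy
  inductive PTy : Type
    | v : PVTy → PTy
    | beh : PTy
end

inductive PTm : Type
  | star : PTm
  | var : Var → PTm
  | lam : Var → PTm → PTm
  | app : PTm → PTm → PTm
  | par : PTm → PTm → PTm

namespace PTm

inductive IsValue : PTm → Prop
  | star : IsValue .star
  | var (x : Var) : IsValue (.var x)
  | lam (x : Var) (M : PTm) : IsValue (.lam x M)

def fv : PTm → Finset Var
  | .star => ∅
  | .var x => {x}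
  | .lam x M => fv M \ {x}
  | .app M N => fv M ∪ fv N
  | .par M N => fv M ∪ fv N

def subst (V : PTm) (x : Var) : PTm → PTm
  | .star => .star
  | .var y => if y = x then V else .var y
  | .lam y M => if y = x then .lam y M else .lam y (subst V x M)
  | .app M N => .app (subst V x M) (subst V x N)
  | .par M N => .par (subst V x M) (subst V x N)

/-- α-equivalence of λ_pr-terms. -/
inductive Aeq : PTm → PTm → Prop
  | star : Aeq .star .star
  | var (x : Var) : Aeq (.var x) (.var x)
  | app {M M' N N'} : Aeq M M' → Aeq N N' → Aeq (.app M N) (.app M' N')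
  | par {M M' N N'} : Aeq M M' → Aeq N N' → Aeq (.par M N) (.par M' N')
  | lam {M N} (x y : Var) :
      (∀ z, z ∉ fv M → z ∉ fv N →
        Aeq (subst (.var z) x M) (subst (.var z) y N)) →
      Aeq (.lam x M) (.lam y N)

end PTm

/-- Evaluation contexts of λ_pr :
`E ::= [ ] | E[[ ] M] | E[V [ ]] | E[[ ] | M] | E[M | [ ]]`. -/
inductive PECtx : Type
  | hole : PECtx
  | appFun : PECtx → PTm → PECtx
  | appArg : PECtx → PTm → PECtx
  | parL : PECtx → PTm → PECtx
  | parR : PTm → PECtx → PECtx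

def PECtx.Ok : PECtx → Prop
  | .hole => True
  | .appFun E _ => E.Ok
  | .appArg E V => PTm.IsValue V ∧ E.Ok
  | .parL E _ => E.Ok
  | .parR _ E => E.Ok

def PECtx.plug : PECtx → PTm → PTm
  | .hole, t => t
  | .appFun E M, t => E.plug (.app t M)
  | .appArg E V, t => E.plug (.app V t)
  | .parL E M, t => E.plug (.par t M)
  | .parR M E, t => E.plug (.par M t)

/-- Call-by-value reduction of λ_pr, closed under α-equivalence. -/
inductive PRed : PTm → PTm → Prop
  | beta (E : PECtx) (x : Var) (M V : PTm) :
      E.Ok → PTm.IsValue V →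
      PRed (E.plug (.app (.lam x M) V)) (E.plug (PTm.subst V x M))
  | equiv {M M' N N' : PTm} : PTm.Aeq M M' → PRed M' N' → PTm.Aeq N' N → PRed M N

def lk {α : Type} : List (Var × α) → Var → Option α
  | [], _ => none
  | (y, A) :: Γ, x => if x = y then some A else lk Γ x

/-- Typing of λ_pr (contexts assign value types). -/
inductive PTyJ : List (Var × PVTy) → PTm → PTy → Prop
  | var {Γ x A} : lk Γ x = some A → PTyJ Γ (.var x) (.v A)
  | star {Γ} : PTyJ Γ .star (.v .unit)
  | lam {Γ x A M α} : PTyJ ((x, A) :: Γ) M α → PTyJ Γ (.lam x M) (.v (.arr A α))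
  | app {Γ M N A α} : PTyJ Γ M (.v (.arr A α)) → PTyJ Γ N (.v A) → PTyJ Γ (.app M N) α
  | par {Γ M₁ M₂} : PTyJ Γ M₁ .beh → PTyJ Γ M₂ .beh → PTyJ Γ (.par M₁ M₂) .beh

/-! ## λᵃ_pr : the concurrent λ-calculus in administrative form -/

/-- Usages `u ∈ {∞, 1, 0}`. -/
inductive Usage : Type
  | inf : Usage
  | one : Usage
  | zero : Usage
deriving DecidableEq

/-- The usage-decreasing operator `↓` (`↓∞ = ∞`, `↓1 = 0`; `↓0` is
undefined and never used). -/
def Usage.down : Usage → Usage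
  | .inf => .inf
  | .one => .zero
  | .zero => .zero

/-! Value types `A ::= Ch(1) | Ch(A⁺ → α)` and types `α ::= A | b`. -/
mutual
  inductive CVTy : Type
    | chUnit : CVTy
    | ch : CFn → CVTy
  inductive CFn : Type
    | last : CVTy → CTy → CFn
    | more : CVTy → CFn → CFn
  inductive CTy : Type
    | v : CVTy → CTy
    | beh : CTy
end

/-! Syntax of λᵃ_pr. -/
mutual
  inductive CVal : Type
    | star : CVal
    | lam : Var → List Var → CDec → CVal
  inductive CDec : Type
    | lett : Usage → Var → CVal → CDec → CDec
    | tm : CTm → CDec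
  inductive CTm : Type
    | var : Var → CTm
    | app : CTm → CSp → CTm
    | par : CTm → CTm → CTm
  inductive CSp : Type
    | single : CTm → CSp
    | cons : CTm → CSp → CSp
end

mutual
  def fvV : CVal → Finset Var
    | .star => ∅
    | .lam y ys D => fvD D \ insert y ys.toFinset
  def fvD : CDec → Finset Var
    | .lett _ x V D => fvV V ∪ (fvD D \ {x})
    | .tm M => fvT M
  def fvT : CTm → Finset Var
    | .var x => {x}
    | .app M sp => fvT M ∪ fvS sp
    | .par M N => fvT M ∪ fvT N
  def fvS : CSp → Finset Var
    | .single M => fvT M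
    | .cons M sp => fvT M ∪ fvS sp
end

mutual
  def varsV : CVal → Finset Var
    | .star => ∅
    | .lam y ys D => varsD D ∪ insert y ys.toFinset
  def varsD : CDec → Finset Var
    | .lett _ x V D => insert x (varsV V ∪ varsD D)
    | .tm M => varsT M
  def varsT : CTm → Finset Var
    | .var x => {x}
    | .app M sp => varsT M ∪ varsS sp
    | .par M N => varsT M ∪ varsT N
  def varsS : CSp → Finset Var
    | .single M => varsT M
    | .cons M sp => varsT M ∪ varsS sp
end

def rlook (σ : List (Var × Var)) (x : Var) : Var :=
  ((σ.find? (fun p => p.1 == x)).map Prod.snd).getD x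

def rdel (σ : List (Var × Var)) (xs : List Var) : List (Var × Var) :=
  σ.filter (fun p => !xs.contains p.1)

mutual
  def rnV (σ : List (Var × Var)) : CVal → CVal
    | .star => .star
    | .lam y ys D => .lam y ys (rnD (rdel σ (y :: ys)) D)
  def rnD (σ : List (Var × Var)) : CDec → CDec
    | .lett u x V D => .lett u x (rnV σ V) (rnD (rdel σ [x]) D)
    | .tm M => .tm (rnT σ M)
  def rnT (σ : List (Var × Var)) : CTm → CTm
    | .var x => .var (rlook σ x)
    | .app M sp => .app (rnT σ M) (rnS σ sp)
    | .par M N => .par (rnT σ M) (rnT σ N)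
  def rnS (σ : List (Var × Var)) : CSp → CSp
    | .single M => .single (rnT σ M)
    | .cons M sp => .cons (rnT σ M) (rnS σ sp)
end

/-! Structural congruence of λᵃ_pr. -/
mutual
  inductive SCv : CVal → CVal → Prop
    | refl (V) : SCv V V
    | symm {V V'} : SCv V V' → SCv V' V
    | trans {V₁ V₂ V₃} : SCv V₁ V₂ → SCv V₂ V₃ → SCv V₁ V₃
    | lam {D D'} (y : Var) (ys : List Var) : SCd D D' → SCv (.lam y ys D) (.lam y ys D')
    | alpha {D} (y z : Var) (ys zs : List Var) :
        (y :: ys).length = (z :: zs).length → (z :: zs).Nodup →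
        (∀ w ∈ z :: zs, w ∉ varsD D) →
        SCv (.lam y ys D) (.lam z zs (rnD ((y :: ys).zip (z :: zs)) D))
  inductive SCd : CDec → CDec → Prop
    | refl (D) : SCd D D
    | symm {D D'} : SCd D D' → SCd D' D
    | trans {D₁ D₂ D₃} : SCd D₁ D₂ → SCd D₂ D₃ → SCd D₁ D₃
    | swap {V₁ V₂ D} (u₁ u₂ : Usage) (x₁ x₂ : Var) :
        x₁ ≠ x₂ → x₁ ∉ fvV V₂ → x₂ ∉ fvV V₁ →
        SCd (.lett u₁ x₁ V₁ (.lett u₂ x₂ V₂ D)) (.lett u₂ x₂ V₂ (.lett u₁ x₁ V₁ D))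
    | gc {V D} (u : Usage) (x : Var) : x ∉ fvD D → SCd (.lett u x V D) D
    | lett {V V' D D'} (u : Usage) (x : Var) :
        SCv V V' → SCd D D' → SCd (.lett u x V D) (.lett u x V' D')
    | tm {M M'} : SCt M M' → SCd (.tm M) (.tm M')
    | alpha {V D} (u : Usage) (x z : Var) :
        z ∉ varsD D → SCd (.lett u x V D) (.lett u z V (rnD [(x, z)] D))
  inductive SCt : CTm → CTm → Prop
    | refl (M) : SCt M M
    | symm {M M'} : SCt M M' → SCt M' M
    | trans {M₁ M₂ M₃} : SCt M₁ M₂ → SCt M₂ M₃ → SCt M₁ M₃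
    | app {M M' sp sp'} : SCt M M' → SCs sp sp' → SCt (.app M sp) (.app M' sp')
    | par {M M' N N'} : SCt M M' → SCt N N' → SCt (.par M N) (.par M' N')
  inductive SCs : CSp → CSp → Prop
    | refl (sp) : SCs sp sp
    | symm {sp sp'} : SCs sp sp' → SCs sp' sp
    | trans {s₁ s₂ s₃} : SCs s₁ s₂ → SCs s₂ s₃ → SCs s₁ s₃
    | single {M M'} : SCt M M' → SCs (.single M) (.single M')
    | cons {M M' sp sp'} : SCt M M' → SCs sp sp' → SCs (.cons M sp) (.cons M' sp')
end

/-! Typing of λᵃ_pr, parametrized by a predicate `P` on value types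
(`P := ⊤` gives λᵃ_pr, `P := MonV` its monadic fragment λᵃᵐ_pr and
`P := KVTy` the CPS fragment λᵃᵏ_pr). -/

inductive PBindC : List Var → CFn → List (Var × CVTy) → List (Var × CVTy) → CTy → Prop
  | last {y A α Γ} : PBindC [y] (.last A α) Γ ((y, A) :: Γ) α
  | more {y ys A f Γ Γ' α} :
      PBindC ys f ((y, A) :: Γ) Γ' α → PBindC (y :: ys) (.more A f) Γ Γ' α

mutual
  inductive TyDc (P : CVTy → Prop) : List (Var × CVTy) → CDec → CTy → Prop
    | star {Γ x D α} : P .chUnit → TyDc P ((x, .chUnit) :: Γ) D α →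
        TyDc P Γ (.lett .inf x .star D) α
    | lam {Γ Γ' u x y ys f D' D α' α} :
        u ≠ .zero → P (.ch f) → PBindC (y :: ys) f Γ Γ' α' → TyDc P Γ' D' α' →
        TyDc P ((x, .ch f) :: Γ) D α →
        TyDc P Γ (.lett u x (.lam y ys D') D) α
    | lam0 {Γ x V f D α} :
        V ≠ .star → P (.ch f) → TyDc P ((x, .ch f) :: Γ) D α →
        TyDc P Γ (.lett .zero x V D) α
    | tm {Γ M α} : TyMc P Γ M α → TyDc P Γ (.tm M) α
  inductive TyMc (P : CVTy → Prop) : List (Var × CVTy) → CTm → CTy → Prop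
    | var {Γ x A} : lk Γ x = some A → TyMc P Γ (.var x) (.v A)
    | app {Γ M sp f α} : TyMc P Γ M (.v (.ch f)) → TySpc P Γ sp f α →
        TyMc P Γ (.app M sp) α
    | par {Γ M₁ M₂} : TyMc P Γ M₁ .beh → TyMc P Γ M₂ .beh → TyMc P Γ (.par M₁ M₂) .beh
  inductive TySpc (P : CVTy → Prop) : List (Var × CVTy) → CSp → CFn → CTy → Prop
    | single {Γ N A α} : TyMc P Γ N (.v A) → TySpc P Γ (.single N) (.last A α) α
    | cons {Γ N rest A f α} : TyMc P Γ N (.v A) → TySpc P Γ rest f α →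
        TySpc P Γ (.cons N rest) (.more A f) α
end

/-! Monadic value types `A ::= Ch(1) | Ch(A → α)`. -/
mutual
  inductive MonV : CVTy → Prop
    | unit : MonV .chUnit
    | ch {A α} : MonV A → MonT α → MonV (.ch (.last A α))
  inductive MonT : CTy → Prop
    | v {A} : MonV A → MonT (.v A)
    | beh : MonT .beh
end

/-! The sub-calculus λᵃ_{pr,∞} : all usages are ∞. -/
mutual
  inductive InfV : CVal → Prop
    | star : InfV .star
    | lam {y ys D} : InfD D → InfV (.lam y ys D)
  inductive InfD : CDec → Prop
    | lett {x V D} : InfV V → InfD D → InfD (.lett .inf x V D)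
    | tm {M} : InfT M → InfD (.tm M)
  inductive InfT : CTm → Prop
    | var (x : Var) : InfT (.var x)
    | app {M sp} : InfT M → InfS sp → InfT (.app M sp)
    | par {M N} : InfT M → InfT N → InfT (.par M N)
  inductive InfS : CSp → Prop
    | single {M} : InfT M → InfS (.single M)
    | cons {M sp} : InfT M → InfS sp → InfS (.cons M sp)
end

/-! ## Readback translation R from λᵃ_{pr,∞} to λ_pr -/

def mkLams (y : Var) (ys : List Var) (t : PTm) : PTm :=
  .lam y (ys.foldr .lam t)

mutual
  def rbV : CVal → PTm
    | .star => .star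
    | .lam y ys D => mkLams y ys (rbD D)
  def rbD : CDec → PTm
    | .lett _ x V D => PTm.subst (rbV V) x (rbD D)
    | .tm M => rbT M
  def rbT : CTm → PTm
    | .var x => .var x
    | .app M sp => rbS (rbT M) sp
    | .par M N => .par (rbT M) (rbT N)
  def rbS : PTm → CSp → PTm
    | f, .single N => .app f (rbT N)
    | f, .cons N sp => rbS (.app f (rbT N)) sp
end

mutual
  def rbVTy : CVTy → PVTy
    | .chUnit => .unit
    | .ch f => rbFn f
  def rbFn : CFn → PVTy
    | .last A α => .arr (rbVTy A) (rbCTy α)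
    | .more A f => .arr (rbVTy A) (.v (rbFn f))
  def rbCTy : CTy → PTy
    | .v A => .v (rbVTy A)
    | .beh => .beh
end

def rbCtx (Γ : List (Var × CVTy)) : List (Var × PVTy) :=
  Γ.map (fun p => (p.1, rbVTy p.2))

/-! ## The administrative translation ⌈·⌉ from λ_pr to λᵃ_pr -/

def letsOf : CDec → List (Usage × Var × CVal)
  | .lett u x V D => (u, x, V) :: letsOf D
  | .tm _ => []

def termOf : CDec → CTm
  | .lett _ _ _ D => termOf D
  | .tm M => M

def wrapLets (l : List (Usage × Var × CVal)) (D : CDec) : CDec :=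
  l.foldr (fun p D => .lett p.1 p.2.1 p.2.2 D) D

def letNames (D : CDec) : Finset Var := ((letsOf D).map (fun p => p.2.1)).toFinset

/-- The administrative translation (relational presentation; fresh names
and the renamings implicit in the `@(D,D')` and `D | D'` abbreviations are
constrained by side conditions). -/
inductive Adm : PTm → CDec → Prop
  | var (x : Var) : Adm (.var x) (.tm (.var x))
  | star (x : Var) : Adm .star (.lett .inf x .star (.tm (.var x)))
  | lam {M D} (x x' : Var) :
      Adm M D → x' ∉ insert x (varsD D) →
      Adm (.lam x M) (.lett .inf x' (.lam x [] D) (.tm (.var x')))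
  | app {M N DM DN} :
      Adm M DM → Adm N DN →
      Disjoint (letNames DM) (varsD DN) → Disjoint (letNames DN) (varsD DM) →
      Adm (.app M N)
        (wrapLets (letsOf DM ++ letsOf DN)
          (.tm (.app (termOf DM) (.single (termOf DN)))))
  | par {M N DM DN} :
      Adm M DM → Adm N DN →
      Disjoint (letNames DM) (varsD DN) → Disjoint (letNames DN) (varsD DM) →
      Adm (.par M N)
        (wrapLets (letsOf DM ++ letsOf DN)
          (.tm (.par (termOf DM) (termOf DN))))

mutual
  def admVTy : PVTy → CVTy
    | .unit => .chUnit
    | .arr A α => .ch (.last (admVTy A) (admCTy α))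
  def admCTy : PTy → CTy
    | .v A => .v (admVTy A)
    | .beh => .beh
end

def admCtx (Γ : List (Var × PVTy)) : List (Var × CVTy) :=
  Γ.map (fun p => (p.1, admVTy p.2))

/-! ## Reduction of λᵃ_pr -/

/-- Evaluation contexts of λᵃ_pr :
`E ::= let_u x = V in [ ] | E[@(x*, [ ], M*)] | E[[ ] | M] | E[M | [ ]]`. -/
inductive CECtx : Type
  | letHole : Usage → Var → CVal → CECtx
  | appHole : CECtx → List Var → List CTm → CECtx
  | parL : CECtx → CTm → CECtx
  | parR : CTm → CECtx → CECtx

def CECtx.Ok : CECtx → Prop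
  | .letHole _ _ _ => True
  | .appHole E xs ms => (xs ≠ [] ∨ ms ≠ []) ∧ E.Ok
  | .parL E _ => E.Ok
  | .parR _ E => E.Ok

def CECtx.bnames : CECtx → Finset Var
  | .letHole _ x _ => {x}
  | .appHole E _ _ => E.bnames
  | .parL E _ => E.bnames
  | .parR _ E => E.bnames

def mkSp : CTm → List CTm → CSp
  | t, [] => .single t
  | t, m :: r => .cons t (mkSp m r)

def mkArgs : List Var → CTm → List CTm → CSp
  | [], t, ms => mkSp t ms
  | y :: r, t, ms => .cons (.var y) (mkArgs r t ms)

def mkApp (xs : List Var) (t : CTm) (ms : List CTm) : CTm :=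
  match xs, ms with
  | [], [] => t
  | [], m :: r => .app t (mkSp m r)
  | x :: xs', _ => .app (.var x) (mkArgs xs' t ms)

def CECtx.plugTm : CECtx → CTm → CDec
  | .letHole u x V, t => .lett u x V (.tm t)
  | .appHole E xs ms, t => E.plugTm (mkApp xs t ms)
  | .parL E M, t => E.plugTm (.par t M)
  | .parR M E, t => E.plugTm (.par M t)

/-- Plugging a declaration: the let-declarations float to the outside. -/
def CECtx.plugD (E : CECtx) (D : CDec) : CDec :=
  wrapLets (letsOf D) (E.plugTm (termOf D))

def varSp (z : Var) (zs : List Var) : CSp :=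
  mkSp (.var z) (zs.map .var)

/-- Reduction of λᵃ_pr :
`E[let_u x = λy⁺.D in E'[@(x,z⁺)]] → E[let_{↓u} x = λy⁺.D in E'[[z⁺/y⁺]D]]`
(for `u ≠ 0`), closed under structural congruence. -/
inductive CRed : CDec → CDec → Prop
  | beta (E E' : CECtx) (u : Usage) (x y : Var) (ys : List Var) (B : CDec)
      (z : Var) (zs : List Var) :
      E.Ok → E'.Ok → x ∉ E'.bnames → u ≠ .zero →
      (z :: zs).length = (y :: ys).length →
      CRed (E.plugD (.lett u x (.lam y ys B) (E'.plugTm (.app (.var x) (varSp z zs)))))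
           (E.plugD (.lett u.down x (.lam y ys B)
              (E'.plugD (rnD ((y :: ys).zip (z :: zs)) B))))
  | equiv {D₁ D₁' D₂ D₂'} : SCd D₁ D₁' → CRed D₁' D₂' → SCd D₂' D₂ → CRed D₁ D₂

/-! ## λᵃᵏ_pr : concurrent administrative forms in CPS style -/

/-! CPS value types `A ::= Ch(1) | Ch(A⁺ → b)`. -/
mutual
  inductive KVTy : CVTy → Prop
    | unit : KVTy .chUnit
    | ch {f} : KFn f → KVTy (.ch f)
  inductive KFn : CFn → Prop
    | last {A} : KVTy A → KFn (.last A .beh)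
    | more {A f} : KVTy A → KFn f → KFn (.more A f)
end

inductive SpVars : CSp → Prop
  | single (z : Var) : SpVars (.single (.var z))
  | cons (z : Var) {sp} : SpVars sp → SpVars (.cons (.var z) sp)

/-! Syntactic CPS fragment λᵃᵏ_pr : terms are `@(x, y⁺)` and parallel
compositions thereof. -/
mutual
  inductive FragV : CVal → Prop
    | star : FragV .star
    | lam {y ys D} : FragD D → FragV (.lam y ys D)
  inductive FragD : CDec → Prop
    | lett {u x V D} : FragV V → FragD D → FragD (.lett u x V D)
    | tm {M} : FragT M → FragD (.tm M)
  inductive FragT : CTm → Prop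
    | app {x sp} : SpVars sp → FragT (.app (.var x) sp)
    | par {M N} : FragT M → FragT N → FragT (.par M N)
end

/-! The CPS type translation: `K*(Ch(1)) = Ch(1)`, `K*(b) = b`,
`K*(Ch(A⁺→α)) = Ch(K*(A)⁺ → K(α) → b)`, `K(A) = Ch(K*(A)→b)`, `K(b) = Ch(1)`. -/
mutual
  def kstarV : CVTy → CVTy
    | .chUnit => .chUnit
    | .ch f => .ch (kfn f)
  def kfn : CFn → CFn
    | .last A α => .more (kstarV A) (.last (kK α) .beh)
    | .more A f => .more (kstarV A) (kfn f)
  /-- `K(α)`. -/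
  def kK : CTy → CVTy
    | .v A => .ch (.last (kstarV A) .beh)
    | .beh => .chUnit
end

def kstarT : CTy → CTy
  | .v A => .v (kstarV A)
  | .beh => .beh

def kCtx (Γ : List (Var × CVTy)) : List (Var × CVTy) :=
  Γ.map (fun p => (p.1, kstarV p.2))

def spSnoc : CSp → CTm → CSp
  | .single M, t => .cons M (.single t)
  | .cons M sp, t => .cons M (spSnoc sp t)

/-! The optimized CPS translation for the concurrent case, as a relation:
`CpsV V V'` is `ψ(V) = V'`, `CpsD D k Dk` is `(D : k) = Dk` and
`CpsM M k Dk` is `(M : k) = Dk`. -/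
mutual
  inductive CpsV : CVal → CVal → Prop
    | star : CpsV .star .star
    | lam {y ys D Dk} (k : Var) :
        k ∉ insert y ys.toFinset → k ∉ varsD D →
        CpsD D k Dk →
        CpsV (.lam y ys D) (.lam y (ys ++ [k]) Dk)
  inductive CpsD : CDec → Var → CDec → Prop
    | lett {u x V V' D Dk k} :
        k ∉ varsD (.lett u x V D) →
        CpsV V V' → CpsD D k Dk →
        CpsD (.lett u x V D) k (.lett u x V' Dk)
    | tm {M k Dk} : CpsM M k Dk → CpsD (.tm M) k Dk
  inductive CpsM : CTm → Var → CDec → Prop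
    | var (x k : Var) : CpsM (.var x) k (.tm (.app (.var k) (.single (.var x))))
    | appVars (x z : Var) (zs : List Var) (k : Var) :
        CpsM (.app (.var x) (varSp z zs)) k
             (.tm (.app (.var x) (spSnoc (varSp z zs) (.var k))))
    | appStep {xs : List Var} {M : CTm} {margs : CSp} {ns : List CTm}
        {k k' y : Var} {u : Usage} {Dbody Dinner : CDec} :
        (xs ≠ [] ∨ ns ≠ []) → u ≠ .zero →
        y ∉ varsT (mkApp xs (.app M margs) ns) → y ≠ k →
        k' ∉ varsT (mkApp xs (.app M margs) ns) → k' ≠ k → k' ≠ y →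
        CpsM (mkApp xs (.var y) ns) k Dbody →
        CpsM (.app M margs) k' Dinner →
        CpsM (mkApp xs (.app M margs) ns) k (.lett u k' (.lam y [] Dbody) Dinner)
    | par {M N DM DN k} :
        CpsM M k DM → CpsM N k DN →
        Disjoint (letNames DM) (varsD DN) → Disjoint (letNames DN) (varsD DM) →
        CpsM (.par M N) k
          (wrapLets (letsOf DM ++ letsOf DN)
            (.tm (.par (termOf DM) (termOf DN))))
end

/-! ## Typing depends only on the variables that occur -/

/-- The contexts `Γ` and `Δ` assign the same types to the variables in `S`. -/
def AgreeOn (S : Set Var) (Γ Δ : List (Var × CVTy)) : Prop :=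
  ∀ x ∈ S, lk Γ x = lk Δ x

namespace AgreeOn

variable {S T : Set Var} {Γ Δ Θ : List (Var × CVTy)}

theorem mono (h : AgreeOn S Γ Δ) (hTS : T ⊆ S) : AgreeOn T Γ Δ :=
  fun x hx => h x (hTS hx)

theorem trans (h : AgreeOn S Γ Δ) (h' : AgreeOn S Δ Θ) : AgreeOn S Γ Θ :=
  fun x hx => (h x hx).trans (h' x hx)

theorem cons (h : AgreeOn S Γ Δ) (p : Var × CVTy) : AgreeOn S (p :: Γ) (p :: Δ) := by
  intro x hx
  simp only [lk, h x hx]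

theorem cons_right (h : AgreeOn S Γ Δ) {x : Var} (hx : x ∉ S) (A : CVTy) :
    AgreeOn S Γ ((x, A) :: Δ) := by
  intro y hy
  have hyx : y ≠ x := fun e => hx (e ▸ hy)
  simp only [lk, if_neg hyx, h y hy]

end AgreeOn

theorem PBindC.exists_agreeOn {S : Set Var} {ys : List Var} {f : CFn}
    {Γ Γ' Δ : List (Var × CVTy)} {α : CTy} (h : PBindC ys f Γ Γ' α) (hΓ : AgreeOn S Γ Δ) :
    ∃ Δ', PBindC ys f Δ Δ' α ∧ AgreeOn S Γ' Δ' := by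
  induction h generalizing Δ with
  | last => exact ⟨_, .last, hΓ.cons _⟩
  | more _ ih =>
    obtain ⟨Δ', hΔ', hag⟩ := ih (hΓ.cons _)
    exact ⟨Δ', .more hΔ', hag⟩

mutual

theorem TyMc.congr_ctx {P : CVTy → Prop} {Δ : List (Var × CVTy)} :
    ∀ {Γ : List (Var × CVTy)} {M : CTm} {α : CTy},
      TyMc P Γ M α → AgreeOn (varsT M) Γ Δ → TyMc P Δ M α
  | _, _, _, .var hx, hΓ => .var ((hΓ _ (by simp [varsT])).symm.trans hx)
  | _, _, _, .app hM hS, hΓ =>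
    .app (hM.congr_ctx (hΓ.mono (by intro y; simp +contextual [varsT])))
      (hS.congr_ctx (hΓ.mono (by intro y; simp +contextual [varsT])))
  | _, _, _, .par hM hN, hΓ =>
    .par (hM.congr_ctx (hΓ.mono (by intro y; simp +contextual [varsT])))
      (hN.congr_ctx (hΓ.mono (by intro y; simp +contextual [varsT])))

theorem TySpc.congr_ctx {P : CVTy → Prop} {Δ : List (Var × CVTy)} :
    ∀ {Γ : List (Var × CVTy)} {sp : CSp} {f : CFn} {α : CTy},
      TySpc P Γ sp f α → AgreeOn (varsS sp) Γ Δ → TySpc P Δ sp f α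
  | _, _, _, _, .single hN, hΓ => .single (hN.congr_ctx (hΓ.mono (by intro y; simp [varsS])))
  | _, _, _, _, .cons hN hS, hΓ =>
    .cons (hN.congr_ctx (hΓ.mono (by intro y; simp +contextual [varsS])))
      (hS.congr_ctx (hΓ.mono (by intro y; simp +contextual [varsS])))

end

theorem TyDc.congr_ctx {P : CVTy → Prop} {Γ Δ : List (Var × CVTy)} {D : CDec} {α : CTy}
    (h : TyDc P Γ D α) (hΓ : AgreeOn (varsD D) Γ Δ) : TyDc P Δ D α := by
  cases h with
  | star hP hD =>
    exact .star hP (hD.congr_ctx ((hΓ.mono (by intro y; simp +contextual [varsD])).cons _))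
  | lam hu hP hB hD' hD =>
    obtain ⟨Δ', hB', hag⟩ := hB.exists_agreeOn hΓ
    exact .lam hu hP hB' (hD'.congr_ctx (hag.mono (by intro y; simp +contextual [varsD, varsV])))
      (hD.congr_ctx ((hΓ.mono (by intro y; simp +contextual [varsD])).cons _))
  | lam0 hV hP hD =>
    exact .lam0 hV hP (hD.congr_ctx ((hΓ.mono (by intro y; simp +contextual [varsD])).cons _))
  | tm hM => exact .tm (hM.congr_ctx (hΓ.mono (by intro y; simp [varsD])))

/-! ## Floating declarations -/

theorem varsT_termOf_subset : ∀ D : CDec, varsT (termOf D) ⊆ varsD D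
  | .lett _ _ _ D => fun _ hy => by
    simp [varsD, varsT_termOf_subset D hy]
  | .tm _ => fun _ hy => by simpa [varsD, termOf] using hy

theorem wrapLets_append (l l' : List (Usage × Var × CVal)) (D : CDec) :
    wrapLets (l ++ l') D = wrapLets l (wrapLets l' D) :=
  List.foldr_append

theorem letNames_lett (u : Usage) (x : Var) (V : CVal) (D : CDec) :
    letNames (.lett u x V D) = insert x (letNames D) := by
  simp [letNames, letsOf]

/-- To type `K` under the declarations of a typed `D`, it suffices to type it in every context
that extends the given one by the declared names and types the body of `D`. -/
theorem TyDc.wrapLets {P : CVTy → Prop} {K : CDec} {α β : CTy} :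
    ∀ {D : CDec} {Γ : List (Var × CVTy)}, TyDc P Γ D α →
      (∀ Δ, AgreeOn {x | x ∉ letNames D} Γ Δ → TyMc P Δ (termOf D) α → TyDc P Δ K β) →
      TyDc P Γ (wrapLets (letsOf D) K) β
  | .tm _, _, .tm hM, hK => hK _ (fun _ _ => rfl) hM
  | .lett u x V D, Γ, h, hK => by
    have hbody : ∀ A, TyDc P ((x, A) :: Γ) D α →
        TyDc P ((x, A) :: Γ) (DecompPi.wrapLets (letsOf D) K) β := by
      intro A hD
      refine hD.wrapLets fun Δ hΔ hM => hK Δ ?_ hM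
      have hΓ : AgreeOn {y | y ∉ letNames (.lett u x V D)} Γ ((x, A) :: Γ) :=
        AgreeOn.cons_right (fun _ _ => rfl) (by simp [letNames_lett]) A
      exact hΓ.trans (hΔ.mono (by intro y; simp +contextual [letNames_lett]))
    cases h with
    | star hP hD => exact .star hP (hbody _ hD)
    | lam hu hP hB hD' hD => exact .lam hu hP hB hD' (hbody _ hD)
    | lam0 hV hP hD => exact .lam0 hV hP (hbody _ hD)

/-- Declarations with non-interfering names can be merged around any term built from
their bodies. -/
theorem TyDc.merge {P : CVTy → Prop} {Γ : List (Var × CVTy)} {D E : CDec} {M : CTm}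
    {α β γ : CTy} (hD : TyDc P Γ D α) (hE : TyDc P Γ E β)
    (hDE : Disjoint (letNames D) (varsD E)) (hED : Disjoint (letNames E) (varsD D))
    (hM : ∀ Δ, TyMc P Δ (termOf D) α → TyMc P Δ (termOf E) β → TyMc P Δ M γ) :
    TyDc P Γ (DecompPi.wrapLets (letsOf D ++ letsOf E) (.tm M)) γ := by
  rw [wrapLets_append]
  refine hD.wrapLets fun Δ hΔ htD => ?_
  have hE' : TyDc P Δ E β :=
    hE.congr_ctx (hΔ.mono fun y hy => Finset.disjoint_right.mp hDE hy)
  refine hE'.wrapLets fun Θ hΘ htE => .tm (hM Θ ?_ htE)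
  exact htD.congr_ctx
    (hΘ.mono fun y hy => Finset.disjoint_right.mp hED (varsT_termOf_subset D hy))

/-! ## The type translation -/

mutual

theorem monV_admVTy : ∀ A : PVTy, MonV (admVTy A)
  | .unit => by simpa only [admVTy] using MonV.unit
  | .arr A α => by simpa only [admVTy] using MonV.ch (monV_admVTy A) (monT_admCTy α)

theorem monT_admCTy : ∀ α : PTy, MonT (admCTy α)
  | .v A => by simpa only [admCTy] using MonT.v (monV_admVTy A)
  | .beh => by simpa only [admCTy] using MonT.beh

end

theorem lk_admCtx {Γ : List (Var × PVTy)} {x : Var} {A : PVTy} (h : lk Γ x = some A) :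
    lk (admCtx Γ) x = some (admVTy A) := by
  induction Γ with
  | nil => simp [lk] at h
  | cons p Γ ih =>
    by_cases hx : x = p.1
    · simp_all [lk, admCtx]
    · simp_all [lk, admCtx]

/-- Theorem 3(3): if `Γ ⊢ M : α` in λ_pr then
`⌈Γ⌉ ⊢ᵃᵐ ⌈M⌉ : ⌈α⌉` in the monadic fragment λᵃᵐ_pr. -/
theorem adm_typing_par (Γ : List (Var × PVTy)) (M : PTm) (α : PTy) (D : CDec)
    (hM : PTyJ Γ M α) (hD : Adm M D) :
    TyDc MonV (admCtx Γ) D (admCTy α) := by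
  induction hM generalizing D with
  | var hx =>
    cases hD
    simpa only [admCTy] using TyDc.tm (.var (lk_admCtx hx))
  | star =>
    cases hD
    simpa only [admCTy, admVTy] using TyDc.star MonV.unit (.tm (.var (by simp [lk])))
  | @lam Γ x A M α _ ih =>
    cases hD with
    | lam _ x' hB _ =>
      have hmon := monV_admVTy (.arr A α)
      simp only [admCTy, admVTy] at hmon ⊢
      exact .lam (by simp) hmon .last (ih _ hB) (.tm (.var (by simp [lk])))
  | app _ _ ihM ihN =>
    cases hD with
    | app hM hN hMN hNM =>
      refine (ihM _ hM).merge (ihN _ hN) hMN hNM fun Δ htM htN => ?_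
      simp only [admCTy, admVTy] at htM htN
      exact .app htM (.single htN)
  | par _ _ ihM ihN =>
    cases hD with
    | par hM hN hMN hNM =>
      refine (ihM _ hM).merge (ihN _ hN) hMN hNM fun Δ htM htN => ?_
      simp only [admCTy] at htM htN ⊢
      exact .par htM htN

end DecompPi
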